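/- Let P be a one-parameter FISI deformation of f₀ of degree d ≥ 2 whose total space Y is nonsingular in a region {|s| < ε} (equivalently, Σ₀ ∩ {φ_d = 0} = ∅), and assume some fiber Y_{0,t} has singular points on the hyperplane at infinity (Σ₀ ≠ ∅). Fix t₀ ∈ ℂ and let (x_k, s_k) be any sequence with s_k ≠ 0, s_k → 0, ∂P/∂x_i(x_k, s_k) = 0 for all i, |x_k| → ∞, and t_k := P(x_k, s_k) → t₀. Then for all large k one has t_k ≠ t₀, and s_k/(t_k − t₀) → 0. (Equivalently: all branches of the affine discriminant Δ_P of type II are tangent to the axis {σ = 0} in the (s,t)-plane.) -/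

import Mathlib

open MvPolynomial Filter CategoryTheory Limits Topology

noncomputable section

abbrev XS (n : ℕ) := Fin n ⊕ Unit
abbrev HV (n : ℕ) := Fin n ⊕ Unit
abbrev TV (n : ℕ) := Fin n ⊕ Fin 3

/-- ℙ^{n-1}, the hyperplane at infinity of ℙⁿ. -/
abbrev PrjInf (n : ℕ) := Projectivization ℂ (Fin n → ℂ)
/-- ℙⁿ. -/
abbrev Prj (n : ℕ) := Projectivization ℂ (HV n → ℂ)

/-- weights for the degree in the `x`-variables only: `s` has weight `0`. -/
def wtx (n : ℕ) : XS n → ℕ := Sum.elim (fun _ => 1) (fun _ => 0)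

/-- `P_q`, the degree-`q` homogeneous part of `P` in the variables `x`. -/
def xpart {n : ℕ} (P : MvPolynomial (XS n) ℂ) (q : ℕ) : MvPolynomial (XS n) ℂ :=
  weightedHomogeneousComponent (wtx n) q P

/-- the evaluation point `(x, s)`. -/
def evA {n : ℕ} (x : Fin n → ℂ) (s : ℂ) : XS n → ℂ := Sum.elim x (fun _ => s)

/-- `deg_x P(·,s) = d` at the parameter value `s`. -/
def DegXAt {n : ℕ} (d : ℕ) (P : MvPolynomial (XS n) ℂ) (s : ℂ) : Prop :=
  (∀ q, d < q → ∀ x : Fin n → ℂ, eval (evA x s) (xpart P q) = 0) ∧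
  (∃ x : Fin n → ℂ, eval (evA x s) (xpart P d) ≠ 0)

/-- the substitution embedding the variables `(x,s)` into the variables `(x,x₀,s,t)`. -/
def embT {n : ℕ} : XS n → MvPolynomial (TV n) ℂ :=
  Sum.elim (fun i => X (Sum.inl i)) (fun _ => X (Sum.inr 1))

/-- The defining polynomial `F = P̃(x,x₀,s) - t·x₀^d` of the total space
`Y ⊂ ℙⁿ × ℂ_s × ℂ_t`, where `P̃ = Σ_{q ≤ d} x₀^{d-q} P_q(x,s)` is the homogenization
of `P` in `x` by the variable `x₀`. -/
def FY {n : ℕ} (d : ℕ) (P : MvPolynomial (XS n) ℂ) : MvPolynomial (TV n) ℂ :=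
  (∑ q ∈ Finset.range (d+1), (X (Sum.inr 0))^(d-q) * aeval embT (xpart P q))
    - X (Sum.inr 2) * (X (Sum.inr 0))^d

/-- the evaluation point `((x,x₀), s, t)` of the variables of `FY`. -/
def evT {n : ℕ} (u : HV n → ℂ) (s t : ℂ) : TV n → ℂ :=
  Sum.elim (fun i => u (Sum.inl i)) ![u (Sum.inr ()), s, t]

/-- `([u], s, t) ∈ Y`. -/
def OnY {n : ℕ} (d : ℕ) (P : MvPolynomial (XS n) ℂ) (u : HV n → ℂ) (s t : ℂ) : Prop :=
  eval (evT u s t) (FY d P) = 0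

/-- all partial derivatives of the defining equation of `Y` — with respect to the
homogeneous coordinates `(x, x₀)` and the affine coordinates `s, t` — vanish at
`([u], s, t)`; together with `OnY` this says `([u],s,t)` is a singular point of `Y`. -/
def AllDerivsVanish {n : ℕ} (d : ℕ) (P : MvPolynomial (XS n) ℂ) (u : HV n → ℂ)
    (s t : ℂ) : Prop :=
  ∀ v : TV n, eval (evT u s t) (pderiv v (FY d P)) = 0

/-- the partial derivatives with respect to the homogeneous coordinates `(x, x₀)`
vanish at `([u], s, t)`; together with `OnY` this says `[u]` is a singular point of the
projective fiber `Y_{s,t}`. -/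
def FiberDerivsVanish {n : ℕ} (d : ℕ) (P : MvPolynomial (XS n) ℂ) (u : HV n → ℂ)
    (s t : ℂ) : Prop :=
  (∀ i : Fin n, eval (evT u s t) (pderiv (Sum.inl i) (FY d P)) = 0) ∧
    eval (evT u s t) (pderiv (Sum.inr 0) (FY d P)) = 0

/-- the partial derivatives with respect to `(x, x₀)` and `t` (but not `s`) vanish;
together with `OnY` this identifies the singular points of `Y_{s,ℂ}`, resp. the critical
points of the projection `σ : Y → ℂ_s`. -/
def SliceDerivsVanish {n : ℕ} (d : ℕ) (P : MvPolynomial (XS n) ℂ) (u : HV n → ℂ)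
    (s t : ℂ) : Prop :=
  FiberDerivsVanish d P u s t ∧ eval (evT u s t) (pderiv (Sum.inr 2) (FY d P)) = 0

/-- `[x] ∈ W_s`: all `∂P_d/∂x_i` vanish at `(x,s)`. -/
def WCond {n : ℕ} (d : ℕ) (P : MvPolynomial (XS n) ℂ) (x : Fin n → ℂ) (s : ℂ) : Prop :=
  ∀ i : Fin n, eval (evA x s) (pderiv (Sum.inl i) (xpart P d)) = 0

/-- `[x] ∈ Σ_s`: moreover `P_{d-1}(x,s) = 0`. -/
def SCond {n : ℕ} (d : ℕ) (P : MvPolynomial (XS n) ℂ) (x : Fin n → ℂ) (s : ℂ) : Prop :=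
  WCond d P x s ∧ eval (evA x s) (xpart P (d-1)) = 0

/-- `φ_d(x) = ∂P_d/∂s (x, 0) = 0`. -/
def PhiCond {n : ℕ} (d : ℕ) (P : MvPolynomial (XS n) ℂ) (x : Fin n → ℂ) : Prop :=
  eval (evA x 0) (pderiv (Sum.inr ()) (xpart P d)) = 0

/-- `W_s ⊂ ℙ^{n-1}` as a set of projective points. -/
def Wset {n : ℕ} (d : ℕ) (P : MvPolynomial (XS n) ℂ) (s : ℂ) : Set (PrjInf n) :=
  {p | WCond d P p.rep s}

/-- `Σ_s ⊂ ℙ^{n-1}` as a set of projective points. -/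
def Sigset {n : ℕ} (d : ℕ) (P : MvPolynomial (XS n) ℂ) (s : ℂ) : Set (PrjInf n) :=
  {p | SCond d P p.rep s}

/-- `f_s = P(·,s)` as a polynomial in `x`. -/
def fS {n : ℕ} (P : MvPolynomial (XS n) ℂ) (s : ℂ) : MvPolynomial (Fin n) ℂ :=
  aeval (Sum.elim X (fun _ => C s)) P

/-- `x` is an affine critical point of `f_s`, i.e. `∂P/∂x_i(x,s) = 0` for all `i`. -/
def CritPt {n : ℕ} (P : MvPolynomial (XS n) ℂ) (x : Fin n → ℂ) (s : ℂ) : Prop :=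
  ∀ i : Fin n, eval (evA x s) (pderiv (Sum.inl i) P) = 0

/-- the set of singular points of the compactified fiber `Y_{s,t} ⊂ ℙⁿ`. -/
def SingYst {n : ℕ} (d : ℕ) (P : MvPolynomial (XS n) ℂ) (s t : ℂ) : Set (Prj n) :=
  {p | OnY d P p.rep s t ∧ FiberDerivsVanish d P p.rep s t}

/-- `f₀ = P(·,0)` is a FISI polynomial: it has finitely many critical points, the
projective closure of each of its fibers has only isolated (= finitely many) singular
points, and the singular locus `W₀` of the slice at infinity is finite. -/
def FISIat {n : ℕ} (d : ℕ) (P : MvPolynomial (XS n) ℂ) (s : ℂ) : Prop :=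
  {x : Fin n → ℂ | CritPt P x s}.Finite ∧ (∀ t : ℂ, (SingYst d P s t).Finite) ∧
    (Wset d P s).Finite

/-- `P` is a FISI deformation: `f₀` is FISI, `W₀` is finite and every `f_s`, for `s` in a
neighbourhood of `0`, has only finitely many critical points. -/
def FISIdef {n : ℕ} (d : ℕ) (P : MvPolynomial (XS n) ℂ) : Prop :=
  FISIat d P 0 ∧ ∃ ε > (0:ℝ), ∀ s : ℂ, ‖s‖ < ε → {x : Fin n → ℂ | CritPt P x s}.Finite

/-- The "Milnor-type" local dimension: given polynomial germs `gs` at a point `a ∈ ℂᵐ`,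
this is the `ℂ`-dimension of the formal power series ring at `a` (identified with
`ℂ[[X]]` via `X ↦ X - a`) modulo the ideal generated by the germs. -/
def germDim {m : ℕ} (gs : Set (MvPolynomial (Fin m) ℂ)) (a : Fin m → ℂ) : ℕ :=
  Module.finrank ℂ (MvPowerSeries (Fin m) ℂ ⧸ Ideal.span
    ((fun g => (MvPolynomial.coeToMvPowerSeries.ringHom
        (aeval (fun i => X i + C (a i)) g) : MvPowerSeries (Fin m) ℂ)) '' gs))

/-- the (choice of an) index `j` with `p.rep j ≠ 0`, used to normalize `v_j = 1`
and to work in the chart `x_j = 1` of `ℙⁿ`. -/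
def jp {n : ℕ} (p : PrjInf n) : Fin n :=
  (Function.ne_iff.mp p.rep_nonzero).choose

lemma jp_spec {n : ℕ} (p : PrjInf n) : p.rep (jp p) ≠ 0 :=
  (Function.ne_iff.mp p.rep_nonzero).choose_spec

/-- the chart coordinates of the point at infinity `p = [v:0]`, where `v` is normalized
by `v_{j(p)} = 1`, in the chart `x_{j(p)} = 1` of `ℙⁿ`; the slot `j(p)` of the chart
carries the coordinate `x₀`, which is `0` at `p`. -/
def chartPt {n : ℕ} (p : PrjInf n) : Fin n → ℂ :=
  fun i => if i = jp p then 0 else p.rep i / p.rep (jp p)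

/-- the chart equation of the compactified fiber `Y_{s,t}` in the chart `x_j = 1` of
`ℙⁿ`: substitute `x_j = 1` in the homogeneous defining equation `FY`, the chart slot `j`
carrying the coordinate `x₀`. -/
def chartEq {n : ℕ} (d : ℕ) (P : MvPolynomial (XS n) ℂ) (j : Fin n) (s t : ℂ) :
    MvPolynomial (Fin n) ℂ :=
  aeval (Sum.elim (fun i => if i = j then 1 else X i) ![X j, C s, C t]) (FY d P)

/-- the chart equation of the hypersurface `{P_d(·,s) = 0} ⊂ ℙ^{n-1}` in the chart
`x_j = 1` of `ℙ^{n-1}` (the chart variable `X j` is unused). -/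
def chartEqInf {n : ℕ} (d : ℕ) (P : MvPolynomial (XS n) ℂ) (j : Fin n) (s : ℂ) :
    MvPolynomial (Fin n) ℂ :=
  aeval (fun i => if i = j then 1 else X i) (aeval (Sum.elim X (fun _ => C s)) (xpart P d))

/-- `μ_p(t,s)`, the Milnor number of the isolated singularity of the compactified fiber
`Y_{s,t}` at the point `p` of the hyperplane at infinity. -/
def muP {n : ℕ} (d : ℕ) (P : MvPolynomial (XS n) ℂ) (p : PrjInf n) (s t : ℂ) : ℕ :=
  germDim (Set.range fun i => pderiv i (chartEq d P (jp p) s t)) (chartPt p)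

/-- `μ_{p,gen}(s) = min_{t ∈ ℂ} μ_p(t,s)`. -/
def muGen {n : ℕ} (d : ℕ) (P : MvPolynomial (XS n) ℂ) (p : PrjInf n) (s : ℂ) : ℕ :=
  sInf (Set.range (muP d P p s))

/-- the local Milnor–Lê number `λ_{p,t}(s) = μ_p(t,s) − μ_{p,gen}(s)`. -/
def lamP {n : ℕ} (d : ℕ) (P : MvPolynomial (XS n) ℂ) (p : PrjInf n) (t s : ℂ) : ℕ :=
  muP d P p s t - muGen d P p s

/-- `μ_p^∞(s)`, the Milnor number at `p` of the hypersurface `{P_d(·,s)=0} ⊂ ℙ^{n-1}`: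
computed in the chart `x_{j(p)} = 1`, adding the generator `X (j p)` to kill the unused
chart variable. -/
def muInf {n : ℕ} (d : ℕ) (P : MvPolynomial (XS n) ℂ) (p : PrjInf n) (s : ℂ) : ℕ :=
  germDim ({g | ∃ i, i ≠ jp p ∧ g = pderiv i (chartEqInf d P (jp p) s)} ∪ {X (jp p)})
    (chartPt p)

/-- the total Milnor number `μ(s)` of the affine singularities of `f_s`. -/
def muTot {n : ℕ} (P : MvPolynomial (XS n) ℂ) (s : ℂ) : ℕ :=
  Module.finrank ℂ (MvPolynomial (Fin n) ℂ ⧸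
    Ideal.span (Set.range fun i => pderiv i (fS P s)))

/-- the local Milnor number `μ_a(f_s)` of `f_s` at the point `a ∈ ℂⁿ`. -/
def muAt {n : ℕ} (P : MvPolynomial (XS n) ℂ) (s : ℂ) (a : Fin n → ℂ) : ℕ :=
  germDim (Set.range fun i => pderiv i (fS P s)) a

/-- the total Milnor–Lê number at infinity `λ(s) = Σ_{p ∈ Σ_s} Σ_{t ∈ ℂ} λ_{p,t}(s)`
(all but finitely many summands vanish). -/
def lamTot {n : ℕ} (d : ℕ) (P : MvPolynomial (XS n) ℂ) (s : ℂ) : ℕ :=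
  ∑ᶠ p ∈ Sigset d P s, ∑ᶠ t : ℂ, lamP d P p t s

/-- the chart coordinates of the affine point `[x : 1] ∈ ℙⁿ` in the chart `x_j = 1`,
the slot `j` carrying the coordinate `x₀` (i.e. `1/x_j`). -/
def chartCo {n : ℕ} (j : Fin n) (x : Fin n → ℂ) : Fin n → ℂ :=
  fun i => if i = j then 1 / x j else x i / x j

/-- the affine discriminant `Δ_P ⊂ ℂ_s × ℂ_t`: the closure of the set of pairs
`(s, f_s(x))` over the affine critical points `x` of `f_s`. -/
def DeltaP {n : ℕ} (P : MvPolynomial (XS n) ℂ) : Set (ℂ × ℂ) :=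
  closure {w : ℂ × ℂ | ∃ x : Fin n → ℂ, CritPt P x w.1 ∧ w.2 = eval (evA x w.1) P}


open IsLocalRing

theorem aux_dvr_embed {R : Type*} [CommRing R] [IsDomain R] [IsDiscreteValuationRing R]
    (j : ℂ →+* R) (hst : ∀ a, ∃ c, a - j c ∈ maximalIdeal R) :
    ∃ φ : R →+* PowerSeries ℂ, Function.Injective φ ∧ (∀ c, φ (j c) = PowerSeries.C c) ∧
      ∀ a ∈ maximalIdeal R, PowerSeries.constantCoeff (φ a) = 0 := by
  obtain ⟨π, hπ⟩ := IsDiscreteValuationRing.exists_irreducible R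
  have hm : maximalIdeal R = Ideal.span {π} := hπ.maximalIdeal_eq
  have hπ0 : π ≠ 0 := hπ.ne_zero
  have hj0 : ∀ c, j c ∈ maximalIdeal R → c = 0 := by
    intro c hc
    by_contra h
    have : IsUnit (j c) := (isUnit_iff_ne_zero.mpr h).map j
    exact (mem_maximalIdeal _).1 hc this
  have hst' : ∀ a, ∃ c b, a = j c + π * b := by
    intro a
    obtain ⟨c, hc⟩ := hst a
    rw [hm, Ideal.mem_span_singleton] at hc
    obtain ⟨b, hb⟩ := hc
    exact ⟨c, b, by rw [← hb]; ring⟩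
  choose st sh hsh using hst'
  have uniq : ∀ c b c' b', j c + π * b = j c' + π * b' → c = c' ∧ b = b' := by
    intro c b c' b' h
    have h1 : j (c - c') = π * (b' - b) := by rw [map_sub]; linear_combination h
    have h2 : c - c' = 0 := hj0 _ (by rw [h1, hm]; exact Ideal.mul_mem_right _ _ (Ideal.mem_span_singleton_self _))
    refine ⟨sub_eq_zero.1 h2, ?_⟩
    rw [h2, map_zero] at h1
    rcases mul_eq_zero.1 h1.symm with h | h
    · exact absurd h hπ0
    · exact (sub_eq_zero.1 h).symm
  have U : ∀ a c b, a = j c + π * b → st a = c ∧ sh a = b := by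
    intro a c b h
    exact uniq _ _ _ _ ((hsh a).symm.trans h)
  have stj : ∀ c, st (j c) = c ∧ sh (j c) = 0 := fun c => U _ _ _ (by ring)
  have sta : ∀ a b, st (a + b) = st a + st b ∧ sh (a + b) = sh a + sh b := by
    intro a b
    apply U
    conv_lhs => rw [hsh a, hsh b]
    rw [map_add]; ring
  have stm : ∀ a b, st (a * b) = st a * st b ∧ sh (a * b) = a * sh b + j (st b) * sh a := by
    intro a b
    apply U
    rw [map_mul]
    linear_combination b * hsh a + j (st a) * hsh b + (π * sh a) * hsh b - π * sh b * hsh a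
  let f : R → PowerSeries ℂ := fun a => PowerSeries.mk fun n => st (sh^[n] a)
  have f0 : ∀ a, PowerSeries.coeff 0 (f a) = st a := by intro a; simp [f]
  have fs : ∀ n a, PowerSeries.coeff (n+1) (f a) = PowerSeries.coeff n (f (sh a)) := by
    intro n a; simp [f]
  have fX : ∀ a, f a = PowerSeries.C (st a) + PowerSeries.X * f (sh a) := by
    intro a; ext n
    cases n with
    | zero => simp [f]
    | succ n => rw [fs]; simp [PowerSeries.coeff_succ_X_mul]
  have fadd : ∀ n a b, PowerSeries.coeff n (f (a + b)) = PowerSeries.coeff n (f a + f b) := by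
    intro n
    induction n with
    | zero => intro a b; rw [map_add, f0, f0, f0, (sta a b).1]
    | succ n ih => intro a b; rw [map_add, fs, fs, fs, (sta a b).2, ih, map_add]
  have fadd' : ∀ a b, f (a + b) = f a + f b := fun a b => by ext n; exact fadd n a b
  have fj : ∀ c, f (j c) = PowerSeries.C c := by
    have : f 0 = 0 := by
      have := fadd' 0 0
      rw [add_zero] at this
      exact left_eq_add.mp this
    intro c
    rw [fX, (stj c).1, (stj c).2, this]; simp
  have fjm : ∀ c n a, PowerSeries.coeff n (f (j c * a)) = c * PowerSeries.coeff n (f a) := by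
    intro c n
    induction n with
    | zero => intro a; rw [f0, f0, (stm _ _).1, (stj c).1]
    | succ n ih => intro a; rw [fs, fs, (stm _ _).2, (stj c).2, mul_zero, add_zero, ih]
  have fmul : ∀ n a b, PowerSeries.coeff n (f (a * b)) = PowerSeries.coeff n (f a * f b) := by
    intro n
    induction n with
    | zero => intro a b; rw [f0, (stm a b).1]; simp [f]
    | succ n ih =>
      intro a b
      have e : f a * f b = PowerSeries.C (st b) * (PowerSeries.C (st a) + PowerSeries.X * f (sh a))
          + PowerSeries.X * (f a * f (sh b)) := by
        rw [← fX a]; conv_lhs => rw [fX b]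
        ring
      rw [e, map_add, PowerSeries.coeff_succ_X_mul, ← ih, PowerSeries.coeff_C_mul, map_add,
        PowerSeries.coeff_succ_X_mul, fs, (stm a b).2, fadd', map_add, fjm]
      simp; ring
  let φ : R →+* PowerSeries ℂ :=
    { toFun := f
      map_one' := by rw [← map_one j, fj]; simp
      map_mul' := fun a b => by ext n; exact fmul n a b
      map_zero' := by rw [← map_zero j, fj]; simp
      map_add' := fadd' }
  have hφπ : φ π = PowerSeries.X := by
    have h := U π 0 1 (by simp)
    change f π = _
    rw [fX, h.1, h.2, ← map_one j, fj]; simp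
  refine ⟨φ, ?_, fj, ?_⟩
  · rw [injective_iff_map_eq_zero]
    intro a ha
    by_contra h0
    obtain ⟨n, u, hu⟩ := IsDiscreteValuationRing.eq_unit_mul_pow_irreducible h0 hπ
    rw [hu, map_mul, map_pow, hφπ] at ha
    have := (u.isUnit.map φ).ne_zero
    rcases mul_eq_zero.1 ha with h | h
    · exact this h
    · exact pow_ne_zero n PowerSeries.X_ne_zero h
  · intro a ha
    rw [hm, Ideal.mem_span_singleton] at ha
    obtain ⟨b, rfl⟩ := ha
    rw [map_mul, hφπ]; simp

theorem aux_order (S T g U w : PowerSeries ℂ) (hS0 : S ≠ 0) (hS : PowerSeries.constantCoeff S = 0)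
    (hT : T = S * g) (hU : PowerSeries.constantCoeff U ≠ 0) (hw : PowerSeries.constantCoeff w = 0)
    (h : U * PowerSeries.derivative ℂ S + w * PowerSeries.derivative ℂ T = 0) : False := by
  have hu : IsUnit (U + w * g) := by
    rw [PowerSeries.isUnit_iff_constantCoeff]
    simp [hw, hU]
  have h2 : S ∣ PowerSeries.derivative ℂ S := by
    rw [← hu.dvd_mul_left]
    refine ⟨-w * PowerSeries.derivative ℂ g, ?_⟩
    rw [hT, Derivation.leibniz] at h
    simp only [smul_eq_mul] at h
    linear_combination h
  obtain ⟨a, ha⟩ : ∃ a : ℕ, S.order = a := by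
    have h3 : S.order ≠ ⊤ := fun h => hS0 (PowerSeries.order_eq_top.1 h)
    exact ⟨_, (ENat.natCast_toNat h3).symm⟩
  have hc : PowerSeries.coeff a S ≠ 0 := by
    have := (PowerSeries.order_eq_nat.1 ha).1; exact this
  have hX : PowerSeries.X ^ a ∣ S := by
    rw [PowerSeries.X_pow_dvd_iff]; exact (PowerSeries.order_eq_nat.1 ha).2
  cases a with
  | zero => exact hc (by simpa using hS)
  | succ a =>
    have := PowerSeries.X_pow_dvd_iff.1 (hX.trans h2) a (by omega)
    rw [PowerSeries.coeff_derivative] at this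
    rcases mul_eq_zero.1 this with h | h
    · exact hc h
    · exact absurd h (by exact_mod_cast Nat.succ_ne_zero a)
theorem aux_chain {σ A : Type*} [Fintype σ] [CommRing A] [Algebra ℂ A] (D : Derivation ℂ A A)
    (f : σ → A) (p : MvPolynomial σ ℂ) :
    D (MvPolynomial.aeval f p) =
      ∑ i, MvPolynomial.aeval f (MvPolynomial.pderiv i p) * D (f i) := by
  classical
  induction p using MvPolynomial.induction_on with
  | C a => simp
  | add p q hp hq => simp [hp, hq, add_mul, Finset.sum_add_distrib]
  | mul_X p i hp =>
    simp only [map_mul, Derivation.leibniz, hp, smul_eq_mul, MvPolynomial.aeval_X, map_add, add_mul,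
      Finset.sum_add_distrib, MvPolynomial.pderiv_X, Finset.mul_sum]
    congr 1
    · rw [Finset.sum_eq_single i]
      · simp
      · intro b _ hb; simp [hb]
      · simp
    · apply Finset.sum_congr rfl; intros; ring
theorem aux_dedekind {E B : Type*} [Field E] [CommRing B] [IsDedekindDomain B]
    (O : ValuationSubring E) (g : B →+* E) (hginj : Function.Injective g) (hBO : ∀ b, g b ∈ O)
    (hne : ∃ b, b ≠ 0 ∧ g b ∈ O.nonunits) (j0 : ℂ →+* B)
    (hst : ∀ a ∈ O, ∃ c : ℂ, a - g (j0 c) ∈ O.nonunits) :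
    ∃ S : Subring E, (∀ b c, g c ≠ 0 → g b / g c ∈ O → g b / g c ∈ S) ∧
      ∃ hc : ∀ c : ℂ, g (j0 c) ∈ S,
      ∃ φ : S →+* PowerSeries ℂ, Function.Injective φ ∧
        (∀ c, φ ⟨_, hc c⟩ = PowerSeries.C c) ∧
        ∀ a : S, (a : E) ∈ O.nonunits ↔ PowerSeries.constantCoeff (φ a) = 0 := by
  let f : B →+* O := g.codRestrict O.toSubring hBO
  let p : Ideal B := (maximalIdeal O).comap f
  have : p.IsPrime := Ideal.IsPrime.comap f
  have hmem : ∀ b : B, b ∈ p ↔ g b ∈ O.nonunits := by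
    intro b
    rw [Ideal.mem_comap, ← ValuationSubring.coe_mem_nonunits_iff]; rfl
  have hp0 : p ≠ ⊥ := by
    intro h
    obtain ⟨b, hb, hb2⟩ := hne
    rw [← hmem, h] at hb2
    exact hb hb2
  let R := Localization.AtPrime p
  have : IsDiscreteValuationRing R :=
    IsLocalization.AtPrime.isDiscreteValuationRing_of_dedekind_domain B hp0 R
  have nuO : ∀ {a b : E}, a ∈ O.nonunits → b ∈ O → a * b ∈ O.nonunits := by
    intro a b ha hb
    rw [ValuationSubring.mem_nonunits_iff] at ha ⊢
    rw [map_mul]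
    exact mul_lt_one_of_lt_of_le ha ((O.valuation_le_one_iff b).2 hb)
  have n1 : (1 : E) ∉ O.nonunits := by
    rw [ValuationSubring.mem_nonunits_iff]; simp
  have unO : ∀ {a : E}, a ∉ O.nonunits → a⁻¹ ∈ O := by
    intro a ha
    rw [ValuationSubring.mem_nonunits_iff_or] at ha
    push Not at ha; exact ha.2
  have hg : ∀ y : p.primeCompl, IsUnit (g y) := by
    intro y
    have h1 : ((y : B) : B) ∉ p := y.2
    rw [hmem] at h1
    rw [isUnit_iff_ne_zero]
    intro h
    apply h1
    rw [h]; exact zero_mem _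
  let ψ : R →+* E := IsLocalization.lift (M := p.primeCompl) hg
  have hψB : ∀ b, ψ (algebraMap B R b) = g b := fun b => IsLocalization.lift_eq hg b
  have hψmk : ∀ r : R, ∃ b : B, ∃ c : p.primeCompl, r = IsLocalization.mk' R b c ∧
      ψ r = g b * (g c)⁻¹ := by
    intro r
    obtain ⟨b, c, rfl⟩ := IsLocalization.exists_mk'_eq p.primeCompl r
    refine ⟨b, c, rfl, ?_⟩
    rw [eq_mul_inv_iff_mul_eq₀ (hg c).ne_zero, ← hψB, ← hψB, ← map_mul, IsLocalization.mk'_spec]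
  have hcinv : ∀ c : p.primeCompl, (g c)⁻¹ ∈ O := by
    intro c
    have h1 : ((c : B) : B) ∉ p := c.2
    rw [hmem] at h1
    exact unO h1
  have hψO : ∀ r, ψ r ∈ O := by
    intro r
    obtain ⟨b, c, -, h⟩ := hψmk r
    rw [h]
    exact mul_mem (hBO b) (hcinv c)
  have hψm : ∀ r, r ∈ maximalIdeal R ↔ ψ r ∈ O.nonunits := by
    intro r
    constructor
    · intro hr
      obtain ⟨b, c, h1, h⟩ := hψmk r
      rw [h1, IsLocalization.AtPrime.mk'_mem_maximal_iff R p, hmem] at hr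
      rw [h]
      exact nuO hr (hcinv c)
    · intro hr
      by_contra h
      rw [mem_maximalIdeal, mem_nonunits_iff, not_not] at h
      obtain ⟨r', hr'⟩ := h.exists_right_inv
      apply n1
      rw [← map_one ψ, ← hr', map_mul]
      exact nuO hr (hψO r')
  have hψinj : Function.Injective ψ := by
    rw [injective_iff_map_eq_zero]
    intro r hr
    obtain ⟨b, c, h1, h⟩ := hψmk r
    rw [h] at hr
    have hb : g b = 0 := by
      rcases mul_eq_zero.1 hr with h | h
      · exact h
      · exact absurd (inv_eq_zero.1 h) (hg c).ne_zero
    have hb2 : b = 0 := hginj (hb.trans (map_zero g).symm)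
    rw [h1, hb2, IsLocalization.mk'_zero]
  have hψsurj : ∀ b c, g c ≠ 0 → g b / g c ∈ O → ∃ r, ψ r = g b / g c := by
    intro b c hgc ha
    obtain ⟨r, hr⟩ := ValuationRing.cond (algebraMap B R c) (algebraMap B R b)
    rcases hr with hr | hr
    · refine ⟨r, ?_⟩
      rw [eq_div_iff hgc, ← hψB, ← hψB, ← hr, map_mul, mul_comm]
    · have h1 : g b * ψ r = g c := by rw [← hψB, ← hψB, ← hr, map_mul]
      have hgb : g b ≠ 0 := by rintro h; rw [h, zero_mul] at h1; exact hgc h1.symm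
      have hu : IsUnit r := by
        by_contra h
        have h2 : r ∈ maximalIdeal R := by rwa [mem_maximalIdeal, mem_nonunits_iff]
        rw [hψm] at h2
        apply n1
        have := nuO h2 ha
        convert this
        rw [← h1]
        have : ψ r ≠ 0 := by rintro h; rw [h, mul_zero] at h1; exact hgc h1.symm
        field_simp
      obtain ⟨r', hr'⟩ := hu.exists_right_inv
      refine ⟨r', ?_⟩
      rw [eq_div_iff hgc, ← h1]
      have : ψ r * ψ r' = 1 := by rw [← map_mul, hr', map_one]
      linear_combination g b * this
  let j : ℂ →+* R := (algebraMap B R).comp j0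
  have hj : ∀ c, ψ (j c) = g (j0 c) := fun c => hψB _
  obtain ⟨φ, hφ1, hφ2, hφ3⟩ := aux_dvr_embed j (by
    intro a
    obtain ⟨c, hc⟩ := hst _ (hψO a)
    refine ⟨c, ?_⟩
    rw [hψm, map_sub, hj]; exact hc)
  let e : R ≃+* ψ.range := RingEquiv.ofBijective ψ.rangeRestrict
    ⟨fun a b h => hψinj (congrArg Subtype.val h), ψ.rangeRestrict_surjective⟩
  have hes : ∀ a : ψ.range, ψ (e.symm a) = a := by
    intro a
    have := e.apply_symm_apply a
    exact congrArg Subtype.val this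
  refine ⟨ψ.range, ?_, fun c => ⟨j c, hj c⟩, φ.comp e.symm.toRingHom, ?_, ?_, ?_⟩
  · intro b c h1 h2
    exact hψsurj b c h1 h2
  · exact hφ1.comp e.symm.injective
  · intro c
    rw [← hφ2]
    change φ (e.symm _) = _
    congr 1
    apply hψinj
    rw [hes, hj]
  · intro a
    change _ ↔ PowerSeries.constantCoeff (φ (e.symm a)) = 0
    rw [← hes a, ← hψm]
    refine ⟨hφ3 _, fun h => ?_⟩
    by_contra h2
    rw [mem_maximalIdeal, mem_nonunits_iff, not_not] at h2
    have := (h2.map φ).map PowerSeries.constantCoeff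
    rw [h] at this
    exact not_isUnit_zero this
open Polynomial in
theorem aux_subring {E : Type*} [Field E] [Algebra ℂ[X] E] (O : ValuationSubring E)
    (hA : ∀ p : ℂ[X], algebraMap ℂ[X] E p ∈ O)
    (hst : ∀ a ∈ O, ∃ c : ℂ, a - algebraMap ℂ[X] E (C c) ∈ O.nonunits)
    (hinj : Function.Injective (algebraMap ℂ[X] E))
    (hX : algebraMap ℂ[X] E X ∈ O.nonunits)
    (T : Set E) (hTf : T.Finite) (hT : ∀ a ∈ T, a ∈ O ∧ IsAlgebraic ℂ[X] a) :
    ∃ S : Subring E, T ⊆ S ∧ ∃ hc : ∀ c : ℂ, algebraMap ℂ[X] E (C c) ∈ S,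
      ∃ φ : S →+* PowerSeries ℂ, Function.Injective φ ∧
        (∀ c, φ ⟨_, hc c⟩ = PowerSeries.C c) ∧
        ∀ a : S, (a : E) ∈ O.nonunits ↔ PowerSeries.constantCoeff (φ a) = 0 := by
  have : FaithfulSMul ℂ[X] E := (faithfulSMul_iff_algebraMap_injective _ _).2 hinj
  let : Algebra (FractionRing ℂ[X]) E := FractionRing.liftAlgebra ℂ[X] E
  have : IsScalarTower ℂ[X] (FractionRing ℂ[X]) E := FractionRing.isScalarTower_liftAlgebra _ _
  let K := IntermediateField.adjoin (FractionRing ℂ[X]) T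
  have : Finite T := hTf
  have : FiniteDimensional (FractionRing ℂ[X]) K := by
    apply IntermediateField.finiteDimensional_adjoin
    intro a ha
    have := (hT a ha).2
    exact ((IsFractionRing.isAlgebraic_iff ℂ[X] (FractionRing ℂ[X]) E).1 this).isIntegral
  let B := integralClosure ℂ[X] K
  have : IsDedekindDomain B := integralClosure.isDedekindDomain ℂ[X] (FractionRing ℂ[X]) K
  have : IsFractionRing B K :=
    integralClosure.isFractionRing_of_finite_extension (FractionRing ℂ[X]) K
  have : IsScalarTower ℂ[X] K E := IsScalarTower.of_algebraMap_eq (fun x => rfl)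
  have hBO : ∀ b : B, ((b : K) : E) ∈ O := by
    intro b
    have h1 : IsIntegral ℂ[X] ((b : K) : E) := by
      have := b.2
      rw [mem_integralClosure_iff] at this
      exact this.map (IsScalarTower.toAlgHom ℂ[X] K E)
    let g : ℂ[X] →+* O := (algebraMap ℂ[X] E).codRestrict O.toSubring hA
    obtain ⟨p, hp, hp2⟩ := h1
    have h2 : IsIntegral O ((b : K) : E) := by
      refine ⟨p.map g, hp.map g, ?_⟩
      rw [Polynomial.eval₂_map]
      exact hp2
    obtain ⟨y, hy⟩ := IsIntegrallyClosed.isIntegral_iff.1 h2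
    rw [← hy]; exact y.2
  obtain ⟨S, hS, hc, φ, h1, h2, h3⟩ := aux_dedekind O ((algebraMap K E).comp (algebraMap B K))
    ((algebraMap K E).injective.comp (IsFractionRing.injective B K)) hBO
    ⟨algebraMap ℂ[X] B X, by
      intro h
      have h2 : algebraMap ℂ[X] E X = 0 := by
        have h3 : (((algebraMap ℂ[X] B X : B) : K) : E) = 0 := by rw [h]; rfl
        exact h3
      exact X_ne_zero (hinj (h2.trans (map_zero _).symm)), hX⟩
    ((algebraMap ℂ[X] B).comp C) hst
  refine ⟨S, ?_, hc, φ, h1, h2, h3⟩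
  intro a ha
  obtain ⟨b, c, hc, h⟩ := IsFractionRing.div_surjective (A := B)
    (⟨a, IntermediateField.subset_adjoin _ _ ha⟩ : K)
  have hc0 : c ≠ 0 := nonZeroDivisors.ne_zero hc
  have hE : a = ((algebraMap K E).comp (algebraMap B K)) b /
      ((algebraMap K E).comp (algebraMap B K)) c := (congrArg Subtype.val h).symm
  have hgc : ((algebraMap K E).comp (algebraMap B K)) c ≠ 0 := by
    intro h
    have h3 : ((c : K) : E) = 0 := h
    exact hc0 (Subtype.ext (Subtype.ext h3))
  have := hS b c hgc
  rw [← hE] at this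
  exact this (hT a ha).1

open Polynomial in
theorem aux_core {E σ : Type*} [Fintype σ] [Field E] [Algebra ℂ E] [Algebra ℂ[X] E]
    [IsScalarTower ℂ ℂ[X] E] (O : ValuationSubring E)
    (hA : ∀ p : ℂ[X], algebraMap ℂ[X] E p ∈ O)
    (hst : ∀ a ∈ O, ∃ c : ℂ, a - algebraMap ℂ E c ∈ O.nonunits)
    (hinj : Function.Injective (algebraMap ℂ[X] E))
    (hX : algebraMap ℂ[X] E X ∈ O.nonunits)
    (z : σ → E) (hzO : ∀ v, z v ∈ O) (hzalg : ∀ v, IsAlgebraic ℂ[X] (z v))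
    (F : MvPolynomial σ ℂ) (vs vt : σ) (hne : vs ≠ vt) (hzs : z vs = algebraMap ℂ[X] E X)
    (t₀ : ℂ) (hF : MvPolynomial.aeval z F = 0)
    (hder : ∀ v, v ≠ vs → v ≠ vt → MvPolynomial.aeval z (MvPolynomial.pderiv v F) = 0)
    (hdt : MvPolynomial.aeval z (MvPolynomial.pderiv vt F) ∈ O.nonunits)
    (hds : MvPolynomial.aeval z (MvPolynomial.pderiv vs F) ∉ O.nonunits) :
    (z vt - algebraMap ℂ E t₀) / z vs ∉ O := by
  classical
  intro hq
  have hCE : ∀ c : ℂ, algebraMap ℂ E c = algebraMap ℂ[X] E (C c) := fun c =>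
    IsScalarTower.algebraMap_apply ℂ ℂ[X] E c
  have hs0 : z vs ≠ 0 := by
    rw [hzs]; intro h
    exact X_ne_zero (hinj (h.trans (map_zero _).symm))
  obtain ⟨S, hTS, hc, φ, h1, h2, h3⟩ := aux_subring O hA
    (by intro a ha; obtain ⟨c, h⟩ := hst a ha; exact ⟨c, by rwa [← hCE]⟩) hinj hX
    (insert ((z vt - algebraMap ℂ E t₀) / z vs) (Set.range z)) ((Set.finite_range z).insert _) (by
      intro a ha
      rcases ha with rfl | ⟨v, rfl⟩
      · refine ⟨hq, ?_⟩
        rw [div_eq_mul_inv, hCE]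
        exact ((hzalg vt).sub (isAlgebraic_algebraMap _)).mul (hzalg vs).inv
      · exact ⟨hzO v, hzalg v⟩)
  let _ : Algebra ℂ S := ((algebraMap ℂ E).codRestrict S (by intro c; rw [hCE]; exact hc c)).toAlgebra
  have hSc : ∀ c, ((algebraMap ℂ S c : S) : E) = algebraMap ℂ E c := fun c => rfl
  let i : S →ₐ[ℂ] E := { S.subtype with commutes' := fun c => rfl }
  have hcomm : ∀ c, φ (algebraMap ℂ S c) = algebraMap ℂ (PowerSeries ℂ) c := by
    intro c
    rw [PowerSeries.algebraMap_apply, Algebra.algebraMap_self, RingHom.id_apply, ← h2]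
    congr 1
    apply Subtype.ext
    rw [hSc, hCE]
  let φ' : S →ₐ[ℂ] PowerSeries ℂ := { φ with commutes' := hcomm }
  let zS : σ → S := fun v => ⟨z v, hTS (Set.mem_insert_of_mem _ ⟨v, rfl⟩)⟩
  let q : S := ⟨_, hTS (Set.mem_insert _ _)⟩
  have hev : ∀ p : MvPolynomial σ ℂ, ((MvPolynomial.aeval zS p : S) : E) = MvPolynomial.aeval z p := by
    intro p
    have := MvPolynomial.comp_aeval_apply zS i p
    exact this
  have hev2 : ∀ p : MvPolynomial σ ℂ, MvPolynomial.aeval (fun v => φ' (zS v)) p = φ' (MvPolynomial.aeval zS p) := by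
    intro p
    exact (MvPolynomial.comp_aeval_apply zS φ' p).symm
  have hzero : ∀ p : MvPolynomial σ ℂ, MvPolynomial.aeval z p = 0 → MvPolynomial.aeval (fun v => φ' (zS v)) p = 0 := by
    intro p hp
    rw [hev2]
    have : MvPolynomial.aeval zS p = 0 := Subtype.ext (by rw [hev, hp]; rfl)
    rw [this, map_zero]
  have hch := aux_chain (PowerSeries.derivative ℂ) (fun v => φ' (zS v)) F
  rw [hzero F hF, map_zero, ← Finset.add_sum_erase _ _ (Finset.mem_univ vs),
    ← Finset.add_sum_erase _ _ (Finset.mem_erase.2 ⟨hne.symm, Finset.mem_univ vt⟩),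
    Finset.sum_eq_zero, add_zero] at hch
  · refine aux_order (φ' (zS vs)) (φ' (zS vt) - PowerSeries.C t₀) (φ' q) (hS0 := ?_) (hS := ?_) (hT := ?_) (hU := ?_) (hw := ?_)
      (U := MvPolynomial.aeval (fun v => φ' (zS v)) (MvPolynomial.pderiv vs F))
      (w := MvPolynomial.aeval (fun v => φ' (zS v)) (MvPolynomial.pderiv vt F)) (h := ?_)
    · intro h
      have : zS vs = 0 := h1 (h.trans (map_zero φ).symm)
      exact hs0 (congrArg Subtype.val this)
    · refine (h3 (zS vs)).1 ?_
      change z vs ∈ _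
      rw [hzs]; exact hX
    · have h4 : zS vt - algebraMap ℂ S t₀ = zS vs * q := by
        apply Subtype.ext
        change z vt - algebraMap ℂ E t₀ = z vs * ((z vt - algebraMap ℂ E t₀) / z vs)
        field_simp
      rw [← map_mul, ← h4, map_sub, AlgHom.commutes]; rfl
    · rw [hev2]
      intro h
      apply hds
      rw [← hev]
      exact (h3 _).2 h
    · rw [hev2]
      apply (h3 _).1
      rw [hev]; exact hdt
    · rw [map_sub]
      have : PowerSeries.derivative ℂ (PowerSeries.C t₀) = 0 := PowerSeries.derivative_C
      rw [this, sub_zero]; exact hch.symm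
  · intro v hv
    simp only [Finset.mem_erase] at hv
    rw [hzero _ (hder v hv.2.1 hv.1), zero_mul]

open Polynomial in
theorem aux_alg {E : Type*} {n : ℕ} [Field E] [Algebra ℂ E] [Algebra ℂ[X] E]
    [IsScalarTower ℂ ℂ[X] E]
    (x : Fin n → E) {ι : Type*} (Q : ι → MvPolynomial (Fin n ⊕ Unit) ℂ)
    (hQ : ∀ i, MvPolynomial.aeval (Sum.elim x (fun _ => algebraMap ℂ[X] E X)) (Q i) = 0)
    (ε : ℝ) (hε : 0 < ε)
    (hfin : ∀ s : ℂ, ‖s‖ < ε →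
      {y : Fin n → ℂ | ∀ i, MvPolynomial.eval (Sum.elim y (fun _ => s)) (Q i) = 0}.Finite)
    (k : Fin n) : IsAlgebraic ℂ[X] (x k) := by
  by_contra htr
  have htr : Transcendental ℂ[X] (x k) := htr
  rw [transcendental_iff_injective] at htr
  let w : Fin n ⊕ Unit → E := Sum.elim x (fun _ => algebraMap ℂ[X] E X)
  let B := (MvPolynomial.aeval (R := ℂ) w).range
  have hw : ∀ v, w v ∈ B := fun v => ⟨MvPolynomial.X v, by simp⟩
  have hXB : ∀ p : ℂ[X], algebraMap ℂ[X] E p ∈ B := by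
    intro p
    induction p using Polynomial.induction_on' with
    | add p q hp hq => rw [map_add]; exact add_mem hp hq
    | monomial m a =>
      rw [← Polynomial.C_mul_X_pow_eq_monomial, map_mul, map_pow]
      refine mul_mem ?_ (pow_mem (hw (Sum.inr ())) m)
      have : algebraMap ℂ[X] E (C a) = algebraMap ℂ E a :=
        (IsScalarTower.algebraMap_apply ℂ ℂ[X] E a).symm
      rw [this]; exact B.algebraMap_mem a
  let g0 : ℂ[X] →+* B := (algebraMap ℂ[X] E).codRestrict B.toSubring hXB
  let xB : B := ⟨x k, hw (Sum.inl k)⟩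
  let g : ℂ[X][X] →+* B := Polynomial.eval₂RingHom g0 xB
  have hgE : ∀ p, ((g p : B) : E) = Polynomial.aeval (x k) p := by
    intro p
    change B.val.toRingHom (Polynomial.eval₂ g0 xB p) = _
    rw [Polynomial.hom_eval₂]; rfl
  have hginj : Function.Injective g := by
    intro p q h
    apply htr
    rw [← hgE, ← hgE, h]
  have hBft : Algebra.FiniteType ℂ B :=
    Algebra.FiniteType.of_surjective (MvPolynomial.aeval (R := ℂ) w).rangeRestrict
      (MvPolynomial.aeval (R := ℂ) w).rangeRestrict_surjective
  have hgC : ∀ c : ℂ, g (C (C c)) = algebraMap ℂ B c := by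
    intro c
    apply Subtype.ext
    rw [hgE]
    simp only [Polynomial.aeval_C]
    exact (IsScalarTower.algebraMap_apply ℂ ℂ[X] E c).symm
  have hft : g.FiniteType := by
    apply RingHom.FiniteType.of_comp_finiteType (f := (C : ℂ[X] →+* ℂ[X][X]).comp C)
    have : g.comp ((C : ℂ[X] →+* ℂ[X][X]).comp C) = algebraMap ℂ B := by
      ext1 c; exact hgC c
    rw [this, RingHom.finiteType_algebraMap]; exact hBft
  have hfp : g.FinitePresentation := RingHom.FinitePresentation.of_finiteType.1 hft
  have hcons := PrimeSpectrum.isConstructible_range_comap hfp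
  obtain ⟨D, hD⟩ := PrimeSpectrum.exists_constructibleSetData_iff.2 hcons
  have hgen : (⟨⊥, Ideal.isPrime_bot⟩ : PrimeSpectrum ℂ[X][X]) ∈ D.toSet := by
    rw [hD]
    refine ⟨⟨⊥, Ideal.isPrime_bot⟩, ?_⟩
    apply PrimeSpectrum.ext
    exact (RingHom.ker_eq_bot_iff_eq_zero g).2 (fun a ha => hginj (ha.trans (map_zero g).symm))
  obtain ⟨f, hf0, hf⟩ : ∃ f : ℂ[X][X], f ≠ 0 ∧ ∀ q : PrimeSpectrum ℂ[X][X], f ∉ q.asIdeal →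
      q ∈ Set.range (PrimeSpectrum.comap g) := by
    rw [PrimeSpectrum.ConstructibleSetData.toSet] at hgen
    simp only [Set.mem_iUnion] at hgen
    obtain ⟨c, hc, hc2⟩ := hgen
    refine ⟨c.f, ?_, ?_⟩
    · intro h
      apply hc2.2
      simp [h]
    · intro q hq
      rw [← hD, PrimeSpectrum.ConstructibleSetData.toSet]
      simp only [Set.mem_iUnion]
      refine ⟨c, hc, ?_, ?_⟩
      · intro a ha
        have := hc2.1 ha
        have h0 : a = 0 := this
        rw [h0]; exact q.asIdeal.zero_mem
      · simpa using hq
  -- choose a good parameter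
  obtain ⟨s, hsε, hs⟩ : ∃ s : ℂ, ‖s‖ < ε ∧ f.map (evalRingHom s) ≠ 0 := by
    have hl : f.leadingCoeff ≠ 0 := leadingCoeff_ne_zero.2 hf0
    have hinf : (Metric.ball (0 : ℂ) ε).Infinite :=
      infinite_of_mem_nhds 0 (Metric.ball_mem_nhds 0 hε)
    obtain ⟨s, hs1, hs2⟩ := (hinf.sdiff (f.leadingCoeff.roots.toFinset.finite_toSet)).nonempty
    refine ⟨s, by simpa using hs1, ?_⟩
    intro h
    apply hs2
    have := congrArg (fun p => p.coeff f.natDegree) h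
    simp only [Polynomial.coeff_map, Polynomial.coeff_zero] at this
    simpa [hl] using this
  have hkey : ∀ ξ : ℂ, (f.map (evalRingHom s)).eval ξ ≠ 0 → ∃ y : Fin n → ℂ,
      (∀ i, MvPolynomial.eval (Sum.elim y (fun _ => s)) (Q i) = 0) ∧ y k = ξ := by
    intro ξ hξ
    let e : ℂ[X][X] →+* ℂ := eval₂RingHom (evalRingHom s) ξ
    have hesurj : Function.Surjective e := fun c => ⟨C (C c), by simp [e]⟩
    have hmax : (RingHom.ker e).IsMaximal := RingHom.ker_isMaximal_of_surjective e hesurj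
    obtain ⟨q, hq⟩ := hf ⟨RingHom.ker e, hmax.isPrime⟩ (by
      change f ∉ RingHom.ker e
      rw [RingHom.mem_ker]
      rw [Polynomial.eval_map] at hξ
      exact hξ)
    obtain ⟨M, hM, hqM⟩ := Ideal.exists_le_maximal q.asIdeal q.2.ne_top
    have hker : ∀ a, e a = 0 → g a ∈ M := by
      intro a ha
      apply hqM
      have : a ∈ (PrimeSpectrum.comap g q).asIdeal := by rw [hq]; exact ha
      exact this
    let _ : Field (B ⧸ M) := Ideal.Quotient.field M
    have : Algebra.FiniteType ℂ (B ⧸ M) :=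
      Algebra.FiniteType.of_surjective (Ideal.Quotient.mkₐ ℂ M) (Ideal.Quotient.mkₐ_surjective ℂ M)
    have : Module.Finite ℂ (B ⧸ M) := finite_of_finite_type_of_isJacobsonRing ℂ (B ⧸ M)
    have hbij := IsAlgClosed.algebraMap_bijective_of_isIntegral (k := ℂ) (K := B ⧸ M)
    let θ : (B ⧸ M) ≃ₐ[ℂ] ℂ := (AlgEquiv.ofBijective (Algebra.ofId ℂ (B ⧸ M)) hbij).symm
    let ψ : B →ₐ[ℂ] ℂ := θ.toAlgHom.comp (Ideal.Quotient.mkₐ ℂ M)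
    have hψM : ∀ b ∈ M, ψ b = 0 := by
      intro b hb
      change θ (Ideal.Quotient.mk M b) = 0
      rw [Ideal.Quotient.eq_zero_iff_mem.2 hb, map_zero]
    have hψg : ∀ a, ψ (g a) = e a := by
      intro a
      have h1 := hψM _ (hker (a - Polynomial.C (Polynomial.C (e a))) (by simp [e]))
      rw [map_sub, map_sub, sub_eq_zero, hgC, AlgHom.commutes] at h1
      exact h1
    refine ⟨fun i => ψ ⟨x i, hw (Sum.inl i)⟩, ?_, ?_⟩
    · intro i
      have h1 : (Sum.elim (fun i => ψ ⟨x i, hw (Sum.inl i)⟩) (fun _ => s) : Fin n ⊕ Unit → ℂ) =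
          fun v => ψ ⟨w v, hw v⟩ := by
        funext v
        rcases v with i | u
        · rfl
        · have h2 := hψg (C X)
          have h3 : g (C X) = ⟨w (Sum.inr u), hw (Sum.inr u)⟩ := by
            apply Subtype.ext; rw [hgE]; simp [w]
          rw [h3] at h2
          simp [h2, e]
      rw [h1, ← MvPolynomial.coe_aeval_eq_eval]
      have h4 := MvPolynomial.comp_aeval_apply (fun v => (⟨w v, hw v⟩ : B)) ψ (Q i)
      have h5 : MvPolynomial.aeval (fun v => (⟨w v, hw v⟩ : B)) (Q i) = 0 := by
        apply Subtype.ext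
        have h6 := MvPolynomial.comp_aeval_apply (fun v => (⟨w v, hw v⟩ : B)) B.val (Q i)
        exact h6.trans (hQ i)
      rw [h5, map_zero] at h4
      exact h4.symm
    · have h2 := hψg X
      have h3 : g X = xB := by simp [g]
      rw [h3] at h2
      change ψ xB = ξ
      simp [h2, e]
  have hinf : {ξ : ℂ | (f.map (evalRingHom s)).eval ξ ≠ 0}.Infinite := by
    have : {ξ : ℂ | (f.map (evalRingHom s)).eval ξ ≠ 0} =
        ((f.map (evalRingHom s)).roots.toFinset : Set ℂ)ᶜ := by
      ext ξ; simp [hs]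
    rw [this]
    exact (Finset.finite_toSet _).infinite_compl
  refine hinf (((hfin s hsε).image (fun y => y k)).subset ?_)
  intro ξ hξ
  obtain ⟨y, hy, hyk⟩ := hkey ξ hξ
  exact ⟨y, hy, hyk⟩
theorem aux_whom {σ A : Type*} [Fintype σ] [CommRing A] [Algebra ℂ A] (w : σ → ℕ) (q : ℕ)
    (p : MvPolynomial σ ℂ) (hp : p.IsWeightedHomogeneous w q) (l : A) (y : σ → A) :
    MvPolynomial.aeval (fun v => l ^ (w v) * y v) p = l ^ q * MvPolynomial.aeval y p := by
  rw [MvPolynomial.aeval_def, MvPolynomial.aeval_def, MvPolynomial.eval₂_eq',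
    MvPolynomial.eval₂_eq', Finset.mul_sum]
  refine Finset.sum_congr rfl fun m hm => ?_
  have h1 := hp (MvPolynomial.mem_support_iff.1 hm)
  have h2 : ∏ i, (l ^ w i * y i) ^ m i = l ^ q * ∏ i, y i ^ m i := by
    simp only [mul_pow, Finset.prod_mul_distrib, ← pow_mul]
    congr 1
    rw [Finset.prod_pow_eq_pow_sum, ← h1, Finsupp.weight_apply, Finsupp.sum_fintype _ _ (by simp)]
    congr 1
    exact Finset.sum_congr rfl fun i _ => by simp [mul_comm]
  rw [h2]; ring

theorem aux_xpart_sum {n d : ℕ} (P : MvPolynomial (XS n) ℂ)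
    (hdeg : ∃ ε > (0:ℝ), ∀ s : ℂ, ‖s‖ < ε → DegXAt d P s) :
    P = ∑ q ∈ Finset.range (d+1), xpart P q := by
  obtain ⟨ε, hε, hdeg⟩ := hdeg
  have hz : ∀ q, d < q → xpart P q = 0 := by
    intro q hq
    refine MvPolynomial.funext_set
      (Sum.elim (fun _ => Set.univ) (fun _ => Metric.ball (0:ℂ) ε)) ?_ ?_
    · rintro (i | i)
      · exact Set.infinite_univ
      · exact infinite_of_mem_nhds 0 (Metric.ball_mem_nhds 0 hε)
    · intro x hx
      have h1 := hx (Sum.inr ()) (Set.mem_univ _)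
      have h2 := (hdeg (x (Sum.inr ())) (by simpa using h1)).1 q hq (fun i => x (Sum.inl i))
      rw [map_zero, ← h2]
      congr 2
      funext v
      rcases v with i | i <;> rfl
  have h := MvPolynomial.sum_weightedHomogeneousComponent (w := wtx n) P
  conv_lhs => rw [← h]
  refine finsum_eq_sum_of_support_subset _ ?_
  intro q hq
  by_contra h
  apply hq
  apply hz
  simpa using h

theorem aux_FY {n d : ℕ} (P : MvPolynomial (XS n) ℂ)
    (hP : P = ∑ q ∈ Finset.range (d+1), xpart P q) {A : Type*} [CommRing A] [Algebra ℂ A]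
    (x : Fin n → A) (l s t : A) :
    MvPolynomial.aeval (Sum.elim (fun i => l * x i) ![l, s, t] : TV n → A) (FY d P) =
      l ^ d * (MvPolynomial.aeval (Sum.elim x (fun _ => s) : XS n → A) P - t) := by
  have hq : ∀ q, MvPolynomial.aeval (Sum.elim (fun i => l * x i) ![l, s, t] : TV n → A)
      (MvPolynomial.aeval embT (xpart P q)) =
      l ^ q * MvPolynomial.aeval (Sum.elim x (fun _ => s) : XS n → A) (xpart P q) := by
    intro q
    rw [← aux_whom (wtx n) q (xpart P q)
      (MvPolynomial.weightedHomogeneousComponent_isWeightedHomogeneous _ _),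
      MvPolynomial.comp_aeval_apply]
    congr 2
    funext v
    rcases v with i | i <;> simp [embT, wtx]
  conv_rhs => rw [hP]
  simp only [FY, map_sub, map_sum, map_mul, map_pow, MvPolynomial.aeval_X, Sum.elim_inr, hq]
  simp only [mul_sub, Finset.mul_sum]
  congr 1
  · refine Finset.sum_congr rfl fun q hq => ?_
    have : q ≤ d := by simpa [Nat.lt_succ_iff] using hq
    rw [← mul_assoc]
    congr 1
    simp [← pow_add, Nat.sub_add_cancel this]
  · simp [mul_comm]

theorem aux_eval0 {σ : Type*} (f : σ → Polynomial ℂ) (p : MvPolynomial σ ℂ) :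
    Polynomial.eval 0 (MvPolynomial.aeval f p) =
      MvPolynomial.eval (fun v => Polynomial.eval 0 (f v)) p := by
  have := MvPolynomial.comp_aeval_apply f (Polynomial.aeval (R := ℂ) (0:ℂ)) p
  simpa [Polynomial.coe_aeval_eq_eval, MvPolynomial.coe_aeval_eq_eval] using this

theorem aux_pd2 {n d : ℕ} (P : MvPolynomial (XS n) ℂ) :
    MvPolynomial.pderiv (Sum.inr 2) (FY d P) = - (MvPolynomial.X (Sum.inr 0)) ^ d := by
  have h1 : ∀ p : MvPolynomial (XS n) ℂ,
      MvPolynomial.pderiv (Sum.inr 2 : TV n) (MvPolynomial.aeval embT p) = 0 := by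
    intro p
    rw [aux_chain]
    refine Finset.sum_eq_zero fun v _ => ?_
    rcases v with i | i <;>
      simp [embT, MvPolynomial.pderiv_X]
  simp only [FY, map_sub, map_sum, Derivation.leibniz, h1]
  simp [MvPolynomial.pderiv_X, Derivation.leibniz_pow]

theorem aux_crit {n d : ℕ} (P : MvPolynomial (XS n) ℂ)
    (hP : P = ∑ q ∈ Finset.range (d+1), xpart P q) (x : Fin n → ℂ) (l s t : ℂ) (hl : l ≠ 0)
    (hc : CritPt P x s) (ht : MvPolynomial.eval (evA x s) P = t) (v : TV n)
    (h1 : v ≠ Sum.inr 1) (h2 : v ≠ Sum.inr 2) :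
    MvPolynomial.eval (Sum.elim (fun i => l * x i) ![l, s, t] : TV n → ℂ)
      (MvPolynomial.pderiv v (FY d P)) = 0 := by
  classical
  have ha : ∀ i, MvPolynomial.eval (Sum.elim (fun i => l * x i) ![l, s, t] : TV n → ℂ)
      (MvPolynomial.pderiv (Sum.inl i) (FY d P)) = 0 := by
    intro i
    let xx : Fin n → Polynomial ℂ := fun j => Polynomial.C (x j) + if j = i then Polynomial.X else 0
    have h := aux_FY P hP xx (Polynomial.C l) (Polynomial.C s) (Polynomial.C t)
    have hD := congrArg (fun p => Polynomial.eval 0 (Polynomial.derivative' p)) h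
    beta_reduce at hD
    rw [aux_chain, Derivation.leibniz, map_sub, aux_chain] at hD
    simp only [Fintype.sum_sum_type, Polynomial.eval_add, Polynomial.eval_finsetSum,
      Polynomial.eval_mul, Polynomial.eval_sub, aux_eval0, smul_eq_mul] at hD
    have e1 : (fun v => Polynomial.eval 0 ((Sum.elim (fun i => Polynomial.C l * xx i)
        ![Polynomial.C l, Polynomial.C s, Polynomial.C t] : TV n → Polynomial ℂ) v)) =
        Sum.elim (fun i => l * x i) ![l, s, t] := by
      funext v
      rcases v with j | j
      · by_cases hj : j = i <;> simp [xx, hj]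
      · fin_cases j <;> simp
    have e2 : (fun v => Polynomial.eval 0 ((Sum.elim xx (fun _ => Polynomial.C s) :
        XS n → Polynomial ℂ) v)) = evA x s := by
      funext v
      rcases v with j | j
      · by_cases hj : j = i <;> simp [xx, hj, evA]
      · simp [evA]
    have e3 : ∀ j, Polynomial.eval 0 (Polynomial.derivative' (xx j)) = if j = i then 1 else 0 := by
      intro j
      by_cases hj : j = i <;> simp [xx, hj, Polynomial.derivative']
    rw [e1, e2] at hD
    have hc' : ∀ i, MvPolynomial.eval (evA x s) (MvPolynomial.pderiv (Sum.inl i) P) = 0 := hc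
    have e4 : ∀ c : ℂ, Polynomial.derivative' (Polynomial.C c) = 0 := fun c =>
      Polynomial.derivative_C
    have e5 : ∀ j, Polynomial.eval 0 (Polynomial.derivative (xx j)) = if j = i then 1 else 0 := e3
    have e6 : Polynomial.derivative' (Polynomial.C l ^ d) = 0 := by
      rw [← Polynomial.C_pow, e4]
    simpa [Fin.sum_univ_three, e4, e5, e6, hc', hl] using hD
  rcases v with i | j
  · exact ha i
  fin_cases j
  · have h := aux_FY P hP (fun i => Polynomial.C (x i)) (Polynomial.C l + Polynomial.X)
      (Polynomial.C s) (Polynomial.C t)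
    have e0 : MvPolynomial.aeval (Sum.elim (fun i => Polynomial.C (x i))
        (fun _ => Polynomial.C s) : XS n → Polynomial ℂ) P = Polynomial.C t := by
      have h3 := MvPolynomial.comp_aeval_apply (evA x s) (Algebra.ofId ℂ (Polynomial ℂ)) P
      have h4 : (fun i => (Algebra.ofId ℂ (Polynomial ℂ)) (evA x s i)) =
          Sum.elim (fun i => Polynomial.C (x i)) (fun _ => Polynomial.C s) := by
        funext v
        rcases v with j | j <;> rfl
      rw [h4] at h3
      rw [← h3]
      rw [← ht, ← MvPolynomial.coe_aeval_eq_eval]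
      rfl
    rw [e0, sub_self, mul_zero] at h
    have hD := congrArg (fun p => Polynomial.eval 0 (Polynomial.derivative' p)) h
    beta_reduce at hD
    rw [aux_chain] at hD
    simp only [Fintype.sum_sum_type, Polynomial.eval_add, Polynomial.eval_finsetSum,
      Polynomial.eval_mul, aux_eval0] at hD
    have e1 : (fun v => Polynomial.eval 0 ((Sum.elim
        (fun i => (Polynomial.C l + Polynomial.X) * Polynomial.C (x i))
        ![Polynomial.C l + Polynomial.X, Polynomial.C s, Polynomial.C t] :
          TV n → Polynomial ℂ) v)) =
        Sum.elim (fun i => l * x i) ![l, s, t] := by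
      funext v
      rcases v with j | j
      · simp
      · fin_cases j <;> simp
    rw [e1] at hD
    have e4 : ∀ c : ℂ, Polynomial.derivative' (Polynomial.C c) = 0 := fun c =>
      Polynomial.derivative_C
    have e5 : Polynomial.derivative' (Polynomial.X : Polynomial ℂ) = 1 := Polynomial.derivative_X
    simpa [Fin.sum_univ_three, ha, e4, e5] using hD
  · exact absurd rfl h1
  · exact absurd rfl h2

theorem aux_germ (U : Ultrafilter ℕ) : ∃ (E : Type) (_ : Field E) (g : (ℕ → ℂ) →+* E)
    (O : ValuationSubring E), Function.Surjective g ∧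
    (∀ f, g f = 0 ↔ ∀ᶠ k in (U : Filter ℕ), f k = 0) ∧
    (∀ f, g f ∈ O ↔ ∃ C : ℝ, ∀ᶠ k in (U : Filter ℕ), ‖f k‖ ≤ C) ∧
    (∀ f, g f ∈ O.nonunits ↔ Tendsto f U (nhds 0)) := by
  let E := Filter.Germ (U : Filter ℕ) ℂ
  let g : (ℕ → ℂ) →+* E := Filter.Germ.coeRingHom (U : Filter ℕ)
  have hgeq : ∀ f f', g f = g f' ↔ ∀ᶠ k in (U : Filter ℕ), f k = f' k := fun f f' =>
    Filter.Germ.coe_eq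
  have hg0 : ∀ f, g f = 0 ↔ ∀ᶠ k in (U : Filter ℕ), f k = 0 := by
    intro f
    rw [← map_zero g, hgeq]; rfl
  have hginv : ∀ f : ℕ → ℂ, (g f)⁻¹ = g f⁻¹ := fun f => rfl
  have hsurj : Function.Surjective g := by
    intro a
    induction a using Filter.Germ.inductionOn with
    | h f => exact ⟨f, rfl⟩
  let S : Subring E :=
    { carrier := {a | ∃ f, g f = a ∧ ∃ C : ℝ, ∀ᶠ k in (U : Filter ℕ), ‖f k‖ ≤ C}
      mul_mem' := by
        rintro _ _ ⟨f, rfl, C, hC⟩ ⟨f', rfl, C', hC'⟩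
        refine ⟨f * f', map_mul _ _ _, C * C', ?_⟩
        filter_upwards [hC, hC'] with k h h'
        rw [Pi.mul_apply, norm_mul]
        exact mul_le_mul h h' (norm_nonneg _) ((norm_nonneg _).trans h)
      one_mem' := ⟨1, map_one _, 1, by simp⟩
      add_mem' := by
        rintro _ _ ⟨f, rfl, C, hC⟩ ⟨f', rfl, C', hC'⟩
        refine ⟨f + f', map_add _ _ _, C + C', ?_⟩
        filter_upwards [hC, hC'] with k h h'
        exact (norm_add_le _ _).trans (add_le_add h h')
      zero_mem' := ⟨0, map_zero _, 0, by simp⟩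
      neg_mem' := by
        rintro _ ⟨f, rfl, C, hC⟩
        exact ⟨-f, map_neg _ _, C, by simpa using hC⟩ }
  let O : ValuationSubring E :=
    { S with
      mem_or_inv_mem' := by
        intro a
        obtain ⟨f, rfl⟩ := hsurj a
        by_cases h : ∀ᶠ k in (U : Filter ℕ), ‖f k‖ ≤ 1
        · exact Or.inl ⟨f, rfl, 1, h⟩
        · refine Or.inr ⟨f⁻¹, (hginv f).symm, 1, ?_⟩
          rw [← Ultrafilter.eventually_not] at h
          filter_upwards [h] with k hk
          rw [Pi.inv_apply, norm_inv]
          exact inv_le_one_of_one_le₀ (not_le.1 hk).le }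
  have hO : ∀ f, g f ∈ O ↔ ∃ C : ℝ, ∀ᶠ k in (U : Filter ℕ), ‖f k‖ ≤ C := by
    intro f
    constructor
    · rintro ⟨f', h, C, hC⟩
      rw [hgeq] at h
      refine ⟨C, ?_⟩
      filter_upwards [h, hC] with k h1 h2
      rwa [← h1]
    · rintro ⟨C, hC⟩
      exact ⟨f, rfl, C, hC⟩
  refine ⟨E, inferInstance, g, O, hsurj, hg0, hO, ?_⟩
  intro f
  rw [ValuationSubring.mem_nonunits_iff_or, hginv, hg0, hO]
  constructor
  · rintro (h | h)
    · exact tendsto_const_nhds.congr' (by filter_upwards [h] with k hk using hk.symm)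
    · rw [Metric.tendsto_nhds]
      intro ε hε
      have h1 : ¬ ∀ᶠ k in (U : Filter ℕ), ‖f⁻¹ k‖ ≤ ε⁻¹ := fun h2 => h ⟨_, h2⟩
      rw [← Ultrafilter.eventually_not] at h1
      filter_upwards [h1] with k hk
      rw [dist_zero_right]
      rw [Pi.inv_apply, norm_inv, not_le] at hk
      have h2 : 0 < ‖f k‖ := inv_pos.1 ((inv_pos.2 hε).trans hk)
      exact (inv_lt_inv₀ hε h2).1 hk
  · intro h
    by_cases h0 : ∀ᶠ k in (U : Filter ℕ), f k = 0
    · exact Or.inl h0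
    · refine Or.inr ?_
      rintro ⟨C, hC⟩
      rw [← Ultrafilter.eventually_not] at h0
      have h1 : Tendsto (fun k => ‖f k‖ * C) U (nhds 0) := by
        have := h.norm.mul_const C
        simpa using this
      have h2 := h1.eventually (gt_mem_nhds (zero_lt_one' ℝ))
      obtain ⟨k, h3, h4, h5⟩ := (hC.and (h0.and h2)).exists
      have h6 : ‖f k‖ * ‖f⁻¹ k‖ ≤ ‖f k‖ * C := mul_le_mul_of_nonneg_left h3 (norm_nonneg _)
      rw [← norm_mul, Pi.inv_apply, mul_inv_cancel₀ h4, norm_one] at h6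
      linarith

theorem aux_ultra {n : ℕ} {σ ι : Type} [Fintype σ] (U : Ultrafilter ℕ) (s : ℕ → ℂ)
    (hs0 : ∀ k, s k ≠ 0) (hs : Tendsto s U (nhds 0)) (x : ℕ → Fin n → ℂ)
    (Q : ι → MvPolynomial (XS n) ℂ) (hQ : ∀ i k, MvPolynomial.eval (evA (x k) (s k)) (Q i) = 0)
    (ε : ℝ) (hε : 0 < ε)
    (hfin : ∀ s : ℂ, ‖s‖ < ε →
      {y : Fin n → ℂ | ∀ i, MvPolynomial.eval (evA y s) (Q i) = 0}.Finite)
    (z : ℕ → σ → ℂ) (hzb : ∀ v, ∃ C : ℝ, ∀ᶠ k in (U : Filter ℕ), ‖z k v‖ ≤ C)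
    (hzalg : ∀ v, ∃ a b : MvPolynomial (XS n) ℂ, ∀ᶠ k in (U : Filter ℕ),
      MvPolynomial.eval (evA (x k) (s k)) b ≠ 0 ∧
      z k v * MvPolynomial.eval (evA (x k) (s k)) b = MvPolynomial.eval (evA (x k) (s k)) a)
    (F : MvPolynomial σ ℂ) (vs vt : σ) (hne : vs ≠ vt) (hzs : ∀ k, z k vs = s k) (t₀ : ℂ)
    (hF : ∀ᶠ k in (U : Filter ℕ), MvPolynomial.eval (z k) F = 0)
    (hder : ∀ v, v ≠ vs → v ≠ vt →
      ∀ᶠ k in (U : Filter ℕ), MvPolynomial.eval (z k) (MvPolynomial.pderiv v F) = 0)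
    (hdt : Tendsto (fun k => MvPolynomial.eval (z k) (MvPolynomial.pderiv vt F)) U (nhds 0))
    (hds : ¬ Tendsto (fun k => MvPolynomial.eval (z k) (MvPolynomial.pderiv vs F)) U (nhds 0)) :
    (∀ᶠ k in (U : Filter ℕ), z k vt ≠ t₀) ∧
      Tendsto (fun k => s k / (z k vt - t₀)) U (nhds 0) := by
  obtain ⟨E, _, g, O, hsurj, hg0, hO, hnu⟩ := aux_germ U
  let _ : Algebra ℂ E := (g.comp (Pi.constRingHom ℕ ℂ)).toAlgebra
  let _ : Algebra (Polynomial ℂ) E :=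
    (g.comp (RingHom.pi fun k => Polynomial.evalRingHom (s k))).toAlgebra
  have hC : ∀ c : ℂ, algebraMap ℂ E c = g (fun _ => c) := fun c => rfl
  have hp : ∀ p : Polynomial ℂ, algebraMap (Polynomial ℂ) E p = g (fun k => p.eval (s k)) :=
    fun p => rfl
  have : IsScalarTower ℂ (Polynomial ℂ) E := IsScalarTower.of_algebraMap_eq (by
    intro c
    rw [hp, hC]
    simp)
  have hXs : algebraMap (Polynomial ℂ) E Polynomial.X = g s := by rw [hp]; simp
  let gA : (ℕ → ℂ) →ₐ[ℂ] E := { g with commutes' := fun c => rfl }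
  have hev : ∀ {τ : Type} (y : ℕ → τ → ℂ) (p : MvPolynomial τ ℂ),
      MvPolynomial.aeval (fun v => g (fun k => y k v)) p =
        g (fun k => MvPolynomial.eval (y k) p) := by
    intro τ y p
    have h1 := MvPolynomial.comp_aeval_apply (fun v => (fun k => y k v : ℕ → ℂ)) gA p
    refine h1.symm.trans ?_
    change g _ = g _
    congr 1
    funext k
    have h2 := MvPolynomial.comp_aeval_apply (fun v => (fun k => y k v : ℕ → ℂ))
      (Pi.evalAlgHom ℂ (fun _ : ℕ => ℂ) k) p
    exact h2
  have hxw : (Sum.elim (fun i => g (fun k => x k i)) (fun _ => algebraMap (Polynomial ℂ) E Polynomial.X) :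
      XS n → E) = fun v => g (fun k => evA (x k) (s k) v) := by
    funext v
    rcases v with i | i
    · rfl
    · exact hXs
  have hxalg : ∀ i, IsAlgebraic (Polynomial ℂ) (g (fun k => x k i)) := by
    intro i
    refine aux_alg (fun i => g (fun k => x k i)) Q ?_ ε hε hfin i
    intro i
    rw [hxw, hev, hg0]
    exact Eventually.of_forall (hQ i)
  have hpalg : ∀ p : MvPolynomial (XS n) ℂ,
      IsAlgebraic (Polynomial ℂ) (g (fun k => MvPolynomial.eval (evA (x k) (s k)) p)) := by
    intro p
    induction p using MvPolynomial.induction_on with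
    | C a =>
      simp only [MvPolynomial.eval_C]
      rw [← hC, IsScalarTower.algebraMap_apply ℂ (Polynomial ℂ) E]
      exact isAlgebraic_algebraMap _
    | add p q hp hq =>
      have := hp.add hq
      rw [← map_add] at this
      have h2 : (fun k => MvPolynomial.eval (evA (x k) (s k)) (p + q)) =
          (fun k => MvPolynomial.eval (evA (x k) (s k)) p) +
            fun k => MvPolynomial.eval (evA (x k) (s k)) q := by
        funext k
        simp only [map_add, Pi.add_apply]
      rw [h2]
      exact this
    | mul_X p v hp =>
      have hv : IsAlgebraic (Polynomial ℂ) (g (fun k => evA (x k) (s k) v)) := by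
        rcases v with i | i
        · exact hxalg i
        · change IsAlgebraic (Polynomial ℂ) (g s)
          rw [← hXs]
          exact isAlgebraic_algebraMap _
      have := hp.mul hv
      rw [← map_mul] at this
      have h2 : (fun k => MvPolynomial.eval (evA (x k) (s k)) (p * MvPolynomial.X v)) =
          (fun k => MvPolynomial.eval (evA (x k) (s k)) p) * fun k => evA (x k) (s k) v := by
        funext k
        simp only [map_mul, MvPolynomial.eval_X, Pi.mul_apply]
      rw [h2]
      exact this
  have hgeq : ∀ f f', (∀ᶠ k in (U : Filter ℕ), f k = f' k) → g f = g f' := by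
    intro f f' h
    rw [← sub_eq_zero, ← map_sub, hg0]
    filter_upwards [h] with k hk
    simp [hk]
  have hbdd : ∀ (f : ℕ → ℂ) (c : ℂ), Tendsto f U (nhds c) → g f ∈ O := by
    intro f c h
    rw [hO]
    refine ⟨‖c‖ + 1, ?_⟩
    filter_upwards [h.norm.eventually (gt_mem_nhds (lt_add_one ‖c‖))] with k hk
    exact hk.le
  have hgs0 : g s ≠ 0 := by
    intro h
    rw [hg0] at h
    obtain ⟨k, hk⟩ := h.exists
    exact hs0 k hk
  have hinj : Function.Injective (algebraMap (Polynomial ℂ) E) := by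
    rw [injective_iff_map_eq_zero]
    intro p hp0
    rw [hp, hg0] at hp0
    by_contra hpne
    have h1 : ∀ᶠ k in (U : Filter ℕ), s k ∈ p.roots.toFinset := by
      filter_upwards [hp0] with k hk
      simp [hpne, hk]
    have h2 : ∀ᶠ k in (U : Filter ℕ), s k ∈ ((p.roots.toFinset.erase 0 : Finset ℂ) : Set ℂ)ᶜ := by
      apply hs.eventually
      exact (Finset.finite_toSet _).isClosed.isOpen_compl.mem_nhds (by simp)
    obtain ⟨k, h3, h4⟩ := (h1.and h2).exists
    apply h4
    rw [Finset.mem_coe, Finset.mem_erase]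
    exact ⟨hs0 k, h3⟩
  have hcore := aux_core O
    (by
      intro p
      rw [hp]
      exact hbdd _ _ ((p.continuous.tendsto 0).comp hs))
    (by
      intro a ha
      obtain ⟨f, rfl⟩ := hsurj a
      rw [hO] at ha
      obtain ⟨C, hC'⟩ := ha
      have hmem : ∀ᶠ k in (U : Filter ℕ), f k ∈ Metric.closedBall (0:ℂ) C := by
        filter_upwards [hC'] with k hk
        simpa using hk
      obtain ⟨c, -, hc⟩ := (isCompact_closedBall (0:ℂ) C).ultrafilter_le_nhds' (U.map f) hmem
      refine ⟨c, ?_⟩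
      rw [hC, ← map_sub, hnu]
      have h1 : Tendsto f U (nhds c) := hc
      have h2 := h1.sub_const c
      rw [sub_self] at h2
      exact h2)
    hinj (by rw [hXs, hnu]; exact hs) (fun v => g (fun k => z k v))
    (by intro v; rw [hO]; exact hzb v)
    (by
      intro v
      obtain ⟨a, b, hab⟩ := hzalg v
      have h1 : g (fun k => MvPolynomial.eval (evA (x k) (s k)) b) ≠ 0 := by
        intro h
        rw [hg0] at h
        obtain ⟨k, h3, h4⟩ := (h.and hab).exists
        exact h4.1 h3
      have h2 : g (fun k => z k v) = g (fun k => MvPolynomial.eval (evA (x k) (s k)) a) *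
          (g (fun k => MvPolynomial.eval (evA (x k) (s k)) b))⁻¹ := by
        rw [eq_mul_inv_iff_mul_eq₀ h1, ← map_mul]
        apply hgeq
        filter_upwards [hab] with k hk
        exact hk.2
      rw [h2]
      exact (hpalg a).mul (hpalg b).inv)
    F vs vt hne
    (by
      rw [hXs]
      exact congrArg g (funext hzs)) t₀
    (by rw [hev, hg0]; exact hF)
    (by
      intro v h1 h2
      rw [hev, hg0]
      exact hder v h1 h2)
    (by rw [hev, hnu]; exact hdt)
    (by rw [hev, hnu]; exact hds)
  let f : ℕ → ℂ := fun k => (z k vt - t₀) / s k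
  have hf : (g (fun k => z k vt) - algebraMap ℂ E t₀) / g (fun k => z k vs) = g f := by
    have h1 : (fun k => z k vs) = s := funext hzs
    rw [h1, div_eq_iff hgs0, hC, ← map_sub, ← map_mul]
    apply hgeq
    refine Eventually.of_forall fun k => ?_
    have := hs0 k
    simp [f, this]
  rw [hf] at hcore
  have hgf : g f ≠ 0 := fun h => hcore (by rw [h]; exact zero_mem _)
  have hfne : ∀ᶠ k in (U : Filter ℕ), ¬ f k = 0 := by
    rw [Ultrafilter.eventually_not, ← hg0]; exact hgf
  have hinv : (g f)⁻¹ = g f⁻¹ := by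
    rw [inv_eq_iff_eq_inv]
    refine eq_inv_of_mul_eq_one_left ?_
    rw [← map_mul, ← map_one g]
    apply hgeq
    filter_upwards [hfne] with k hk
    simp [hk]
  constructor
  · filter_upwards [hfne] with k hk h
    exact hk (by simp [f, h])
  · have h1 : (g f)⁻¹ ∈ O.nonunits := (ValuationSubring.inv_mem_nonunits_iff O).2 (Or.inr hcore)
    rw [hinv, hnu] at h1
    refine h1.congr fun k => ?_
    simp [f]

/-- For a FISI deformation with nonsingular total space `Y` (for `|s|`
small) and `Σ₀ ≠ ∅`: whenever affine critical points `(x_k, s_k)` escape to infinity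
(`s_k ≠ 0`, `s_k → 0`, `|x_k| → ∞`) with critical values `t_k = P(x_k,s_k) → t₀ ∈ ℂ`,
then eventually `t_k ≠ t₀` and `s_k/(t_k − t₀) → 0`; i.e. all type II branches of the
affine discriminant are tangent to the axis `{σ = 0}`. -/
theorem stmt8 {n d : ℕ} (hn : 2 ≤ n) (hd : 2 ≤ d) (P : MvPolynomial (XS n) ℂ)
    (hdeg : ∃ ε > (0:ℝ), ∀ s : ℂ, ‖s‖ < ε → DegXAt d P s)
    (hfisi : FISIdef d P)
    (hY : ∃ ε > (0:ℝ), ∀ (u : HV n → ℂ), u ≠ 0 → ∀ s t : ℂ, ‖s‖ < ε →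
      ¬ (OnY d P u s t ∧ AllDerivsVanish d P u s t))
    (hSig : ∃ x : Fin n → ℂ, x ≠ 0 ∧ SCond d P x 0)
    (t₀ : ℂ) (x : ℕ → Fin n → ℂ) (s : ℕ → ℂ)
    (hs0 : ∀ k, s k ≠ 0)
    (hs : Tendsto s atTop (nhds 0))
    (hcrit : ∀ k, CritPt P (x k) (s k))
    (hxinf : Tendsto (fun k => ‖x k‖) atTop atTop)
    (ht : Tendsto (fun k => eval (evA (x k) (s k)) P) atTop (nhds t₀)) :
    (∃ K, ∀ k ≥ K, eval (evA (x k) (s k)) P ≠ t₀) ∧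
      Tendsto (fun k => s k / (eval (evA (x k) (s k)) P - t₀)) atTop (nhds 0) := by
  obtain ⟨εf, hεf, hfin⟩ := hfisi.2
  obtain ⟨εY, hεY, hYns⟩ := hY
  have hP := aux_xpart_sum P hdeg
  have key : ∀ U : Ultrafilter ℕ, (U : Filter ℕ) ≤ atTop →
      (∀ᶠ k in (U : Filter ℕ), eval (evA (x k) (s k)) P ≠ t₀) ∧
      Tendsto (fun k => s k / (eval (evA (x k) (s k)) P - t₀)) U (nhds 0) := by
    intro U hU
    have hne : Nonempty (Fin n) := ⟨⟨0, by omega⟩⟩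
    have hmax : ∀ k, ∃ j, ∀ i, ‖x k i‖ ≤ ‖x k j‖ := fun k => Finite.exists_max (fun i => ‖x k i‖)
    choose jj hjj using hmax
    have hnorm : ∀ k, ‖x k‖ = ‖x k (jj k)‖ := fun k =>
      le_antisymm ((pi_norm_le_iff_of_nonneg (norm_nonneg _)).2 (hjj k)) (norm_le_pi_norm _ _)
    obtain ⟨j, hj⟩ := Ultrafilter.eq_pure_of_finite (U.map jj)
    have hjU : ∀ᶠ k in (U : Filter ℕ), jj k = j := by
      have h1 : ({j} : Set (Fin n)) ∈ U.map jj := by rw [hj]; exact Set.mem_singleton j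
      exact h1
    have hxU : Tendsto (fun k => ‖x k‖) U atTop := hxinf.mono_left hU
    have hsU : Tendsto s U (nhds 0) := hs.mono_left hU
    have htU : Tendsto (fun k => eval (evA (x k) (s k)) P) U (nhds t₀) := ht.mono_left hU
    have hxj : Tendsto (fun k => ‖x k j‖) U atTop := hxU.congr' (by
      filter_upwards [hjU] with k hk
      rw [hnorm, hk])
    have hxj0 : ∀ᶠ k in (U : Filter ℕ), x k j ≠ 0 := by
      filter_upwards [hxj.eventually_gt_atTop 0] with k hk
      exact norm_pos_iff.1 hk
    have hinv0 : Tendsto (fun k => (x k j)⁻¹) U (nhds 0) := by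
      rw [tendsto_zero_iff_norm_tendsto_zero]
      simp only [norm_inv]
      exact tendsto_inv_atTop_zero.comp hxj
    let z : ℕ → TV n → ℂ := fun k => Sum.elim (fun i => (x k j)⁻¹ * x k i)
      ![(x k j)⁻¹, s k, eval (evA (x k) (s k)) P]
    have hbdd : ∀ (f : ℕ → ℂ) (c : ℂ), Tendsto f U (nhds c) →
        ∃ C : ℝ, ∀ᶠ k in (U : Filter ℕ), ‖f k‖ ≤ C := by
      intro f c h
      refine ⟨‖c‖ + 1, ?_⟩
      filter_upwards [h.norm.eventually (gt_mem_nhds (lt_add_one ‖c‖))] with k hk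
      exact hk.le
    have hzb : ∀ v, ∃ C : ℝ, ∀ᶠ k in (U : Filter ℕ), ‖z k v‖ ≤ C := by
      rintro (i | i)
      · refine ⟨1, ?_⟩
        filter_upwards [hjU, hxj0] with k hk h0
        change ‖(x k j)⁻¹ * x k i‖ ≤ 1
        rw [norm_mul, norm_inv, inv_mul_le_iff₀ (norm_pos_iff.2 h0), mul_one, ← hk]
        exact hjj k i
      · fin_cases i
        · exact hbdd _ _ hinv0
        · exact hbdd _ _ hsU
        · exact hbdd _ _ htU
    have hlim : ∀ v, ∃ c : ℂ, Tendsto (fun k => z k v) U (nhds c) := by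
      intro v
      obtain ⟨C, hC⟩ := hzb v
      have hmem : ∀ᶠ k in (U : Filter ℕ), z k v ∈ Metric.closedBall (0:ℂ) C := by
        filter_upwards [hC] with k hk
        simpa using hk
      obtain ⟨c, -, hc⟩ := (isCompact_closedBall (0:ℂ) C).ultrafilter_le_nhds'
        (U.map fun k => z k v) hmem
      exact ⟨c, hc⟩
    choose w hw using hlim
    have hwt : Tendsto z U (nhds w) := tendsto_pi_nhds.2 hw
    have hevt : ∀ p : MvPolynomial (TV n) ℂ,
        Tendsto (fun k => eval (z k) p) U (nhds (eval w p)) := fun p =>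
      ((MvPolynomial.continuous_eval p).tendsto w).comp hwt
    have hF : ∀ᶠ k in (U : Filter ℕ), eval (z k) (FY d P) = 0 := by
      refine Eventually.of_forall fun k => ?_
      have h1 := aux_FY P hP (x k) (x k j)⁻¹ (s k) (eval (evA (x k) (s k)) P)
      have h2 : ∀ (τ : Type) (y : τ → ℂ) (p : MvPolynomial τ ℂ),
          MvPolynomial.aeval y p = MvPolynomial.eval y p := fun τ y p => by
        rw [← MvPolynomial.coe_aeval_eq_eval]; rfl
      rw [h2, h2] at h1
      exact h1.trans (mul_eq_zero_of_right _ (sub_self _))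
    have hder : ∀ v, v ≠ (Sum.inr 1 : TV n) → v ≠ Sum.inr 2 →
        ∀ᶠ k in (U : Filter ℕ), eval (z k) (pderiv v (FY d P)) = 0 := by
      intro v h1 h2
      filter_upwards [hxj0] with k hk
      exact aux_crit P hP (x k) (x k j)⁻¹ (s k) _ (inv_ne_zero hk) (hcrit k) rfl v h1 h2
    have hdt : Tendsto (fun k => eval (z k) (pderiv (Sum.inr 2) (FY d P))) U (nhds 0) := by
      have h1 : ∀ k, eval (z k) (pderiv (Sum.inr 2) (FY d P)) = - ((x k j)⁻¹) ^ d := by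
        intro k
        rw [aux_pd2]
        simp [z]
      simp only [h1]
      have h2 := (hinv0.pow d).neg
      rwa [zero_pow (by omega), neg_zero] at h2
    have hw1 : w (Sum.inr 1) = 0 := tendsto_nhds_unique (hw (Sum.inr 1)) hsU
    have hw2 : w (Sum.inr 2) = t₀ := tendsto_nhds_unique (hw (Sum.inr 2)) htU
    have hwj : w (Sum.inl j) = 1 := by
      refine tendsto_nhds_unique (hw (Sum.inl j)) (tendsto_const_nhds.congr' ?_)
      filter_upwards [hxj0] with k hk
      exact (inv_mul_cancel₀ hk).symm
    let u : HV n → ℂ := Sum.elim (fun i => w (Sum.inl i)) (fun _ => w (Sum.inr 0))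
    have huw : evT u 0 t₀ = w := by
      funext v
      rcases v with i | i
      · rfl
      · fin_cases i
        · rfl
        · exact hw1.symm
        · exact hw2.symm
    have hu0 : u ≠ 0 := by
      intro h
      have h1 := congrFun h (Sum.inl j)
      change w (Sum.inl j) = 0 at h1
      rw [hwj] at h1
      exact one_ne_zero h1
    have hzero : ∀ p : MvPolynomial (TV n) ℂ, (∀ᶠ k in (U : Filter ℕ), eval (z k) p = 0) →
        eval w p = 0 := by
      intro p hp
      refine tendsto_nhds_unique (hevt p) (tendsto_const_nhds.congr' ?_)
      filter_upwards [hp] with k hk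
      exact hk.symm
    have hds : ¬ Tendsto (fun k => eval (z k) (pderiv (Sum.inr 1) (FY d P))) U (nhds 0) := by
      intro h
      refine hYns u hu0 0 t₀ (by simpa using hεY) ⟨?_, ?_⟩
      · change eval (evT u 0 t₀) (FY d P) = 0
        rw [huw]
        exact hzero _ hF
      · intro v
        rw [huw]
        by_cases h1 : v = Sum.inr 1
        · rw [h1]
          exact tendsto_nhds_unique (hevt _) h
        by_cases h2 : v = Sum.inr 2
        · rw [h2]
          exact tendsto_nhds_unique (hevt _) hdt
        exact hzero _ (hder v h1 h2)
    have hzalg : ∀ v, ∃ a b : MvPolynomial (XS n) ℂ, ∀ᶠ k in (U : Filter ℕ),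
        eval (evA (x k) (s k)) b ≠ 0 ∧
        z k v * eval (evA (x k) (s k)) b = eval (evA (x k) (s k)) a := by
      rintro (i | i)
      · refine ⟨X (Sum.inl i), X (Sum.inl j), ?_⟩
        filter_upwards [hxj0] with k hk
        simp only [eval_X, evA, Sum.elim_inl, z]
        refine ⟨hk, ?_⟩
        field_simp
      · fin_cases i
        · refine ⟨1, X (Sum.inl j), ?_⟩
          filter_upwards [hxj0] with k hk
          simp [evA, z, hk]
        · refine ⟨X (Sum.inr ()), 1, ?_⟩
          refine Eventually.of_forall fun k => ?_
          simp [evA, z]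
        · refine ⟨P, 1, ?_⟩
          refine Eventually.of_forall fun k => ?_
          simp [z]
    exact aux_ultra U s hs0 hsU x (fun i => pderiv (Sum.inl i) P) (fun i k => hcrit k i) εf hεf
      hfin z hzb hzalg (FY d P) (Sum.inr 1) (Sum.inr 2) (by simp) (fun k => rfl) t₀ hF hder hdt hds
  constructor
  · have h1 : {k | eval (evA (x k) (s k)) P ≠ t₀} ∈ (atTop : Filter ℕ) :=
      mem_iff_ultrafilter.2 fun U hU => (key U hU).1
    exact eventually_atTop.1 h1
  · exact (tendsto_iff_ultrafilter _ _ _).2 fun U hU => (key U hU).2
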